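/- arXiv:1511.06480 — 2 statements merged into one kernel-verified Lean document; each statement's English description precedes it below -/
import Mathlib

section
/- Let S be a set of N points in ℝ^d, let 0 < ε < 1, and let A ∈ ℝ^{k×d} be a random matrix with i.i.d. entries drawn from the standard Gaussian distribution N(0,1). Then with probability at least 1 − 2N²e^{−(ε²−ε³)k/4}, for every pair x, y ∈ S: (1−ε)‖x−y‖₂ ≤ (1/√k)‖A(x−y)‖₂ ≤ (1+ε)‖x−y‖₂. -/
open MeasureTheory ProbabilityTheory Real
open scoped ENNReal

noncomputable section

/-- Entrywise sign: `sgn t = 1` if `t ≥ 0`, `-1` otherwise. -/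
def sgn (t : ℝ) : ℝ := if 0 ≤ t then 1 else -1

/-- Euclidean (ℓ²) norm. -/
def l2norm {ι : Type*} [Fintype ι] (x : ι → ℝ) : ℝ := Real.sqrt (∑ i, x i ^ 2)

/-- Entrywise ℓ¹ norm. -/
def l1norm {ι : Type*} [Fintype ι] (x : ι → ℝ) : ℝ := ∑ i, |x i|

/-- Supremum (ℓ∞) norm. -/
def linf {ι : Type*} [Fintype ι] (x : ι → ℝ) : ℝ := ⨆ i, |x i|

/-- Euclidean inner product. -/
def dotp {ι : Type*} [Fintype ι] (x y : ι → ℝ) : ℝ := ∑ i, x i * y i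

/-- Angle between two vectors. -/
def angle' {ι : Type*} [Fintype ι] (x y : ι → ℝ) : ℝ :=
  Real.arccos (dotp x y / (l2norm x * l2norm y))

/-- The standard Gaussian measure on `ℝ^d` (i.i.d. `N(0,1)` coordinates). -/
def gaussPi (d : ℕ) : Measure (Fin d → ℝ) := Measure.pi fun _ => gaussianReal 0 1

/-- The Rademacher measure on `ℝ`: `±1` with probability `1/2` each. -/
def radMeasure : Measure ℝ := (2 : ℝ≥0∞)⁻¹ • (Measure.dirac 1 + Measure.dirac (-1))

instance : IsProbabilityMeasure radMeasure := by
  constructor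
  simp only [radMeasure, Measure.smul_apply, Measure.coe_add, Pi.add_apply,
    Measure.dirac_apply' _ MeasurableSet.univ, Set.indicator_univ, Pi.one_apply, smul_eq_mul]
  rw [one_add_one_eq_two, ENNReal.inv_mul_cancel] <;> simp

instance (d : ℕ) : IsProbabilityMeasure (gaussPi d) := by
  unfold gaussPi; infer_instance

/-- i.i.d. Rademacher signs on `ℝ^d`. -/
def radPi (d : ℕ) : Measure (Fin d → ℝ) := Measure.pi fun _ => radMeasure

instance (d : ℕ) : IsProbabilityMeasure (radPi d) := by
  unfold radPi; infer_instance

/-- Circular shift by `t` positions: the `j`-th entry of `shift t x` is `x ((j - t) mod d)`. -/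
def shift {d : ℕ} (t : ℕ) (x : Fin d → ℝ) : Fin d → ℝ :=
  fun j => x ⟨((j : ℕ) + (d - t % d)) % d, Nat.mod_lt _ j.pos⟩

/-- The `k`-bit circulant binary embedding: `sign` of the first `k` entries of
`circ(r) · D · x`, where `D = diag D`. -/
def cbe {d k : ℕ} (hk : k ≤ d) (r D x : Fin d → ℝ) : Fin k → ℝ :=
  fun i => sgn (∑ j, r (Fin.castLE hk i - j) * (D j * x j))


/-- Density form of the integrand of the moment generating function of `Z ^ 2`. -/
lemma gaussianPDFReal_mul_exp_sq {r : ℝ} (z : ℝ) :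
    gaussianPDFReal 0 1 z * exp ((1 - (r ^ 2)⁻¹) / 2 * z ^ 2) =
      (√(2 * π))⁻¹ * exp (-((r ^ 2)⁻¹ / 2) * z ^ 2) := by
  simp only [gaussianPDFReal, NNReal.coe_one, mul_one, sub_zero]
  rw [mul_assoc, ← exp_add]
  ring_nf

lemma integral_exp_sq_gaussianReal {r : ℝ} (hr : 0 < r) :
    ∫ z, exp ((1 - (r ^ 2)⁻¹) / 2 * z ^ 2) ∂gaussianReal 0 1 = r := by
  rw [integral_gaussianReal_eq_integral_smul one_ne_zero]
  simp_rw [smul_eq_mul, gaussianPDFReal_mul_exp_sq]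
  rw [integral_const_mul, integral_gaussian,
    show π / ((r ^ 2)⁻¹ / 2) = (2 * π) * r ^ 2 by field_simp,
    sqrt_mul (by positivity) (r ^ 2), sqrt_sq hr.le]
  have : √(2 * π) ≠ 0 := by positivity
  field_simp

lemma integrable_exp_sq_gaussianReal {r : ℝ} (hr : 0 < r) :
    Integrable (fun z ↦ exp ((1 - (r ^ 2)⁻¹) / 2 * z ^ 2)) (gaussianReal 0 1) :=
  .of_integral_ne_zero (by rw [integral_exp_sq_gaussianReal hr]; exact hr.ne')

lemma mgf_sum_sq_gaussPi (k : ℕ) {r : ℝ} (hr : 0 < r) :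
    mgf (fun z : Fin k → ℝ ↦ ∑ i, z i ^ 2) (gaussPi k) ((1 - (r ^ 2)⁻¹) / 2) = r ^ k := by
  simp only [mgf, Finset.mul_sum, exp_sum, gaussPi]
  rw [integral_fintype_prod_eq_pow fun z : ℝ ↦ exp ((1 - (r ^ 2)⁻¹) / 2 * z ^ 2),
    integral_exp_sq_gaussianReal hr, Fintype.card_fin]

lemma integrable_exp_sum_sq_gaussPi (k : ℕ) {r : ℝ} (hr : 0 < r) :
    Integrable (fun z : Fin k → ℝ ↦ exp ((1 - (r ^ 2)⁻¹) / 2 * ∑ i, z i ^ 2)) (gaussPi k) := by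
  simp only [Finset.mul_sum, exp_sum, gaussPi]
  exact .fintype_prod fun _ ↦ integrable_exp_sq_gaussianReal hr

lemma exp_mul_pow_le (k : ℕ) {r : ℝ} (hr : 0 < r) :
    exp (-((1 - (r ^ 2)⁻¹) / 2) * (r ^ 2 * k)) * r ^ k ≤ exp (-(r - 1) ^ 2 / 2 * k) := by
  have h : r ^ k ≤ exp (k * (r - 1)) := by
    rw [exp_nat_mul]
    gcongr
    linarith [add_one_le_exp (r - 1)]
  calc _ ≤ exp (-((1 - (r ^ 2)⁻¹) / 2) * (r ^ 2 * k)) * exp (k * (r - 1)) := by gcongr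
    _ = _ := by
      rw [← exp_add]
      congr 1
      field_simp
      ring

/-- Upper tail of a chi-square variable with `k` degrees of freedom. -/
lemma gaussPi_upper_tail (k : ℕ) {r : ℝ} (hr : 1 ≤ r) :
    (gaussPi k).real {z | r ^ 2 * k ≤ ∑ i, z i ^ 2} ≤ exp (-(r - 1) ^ 2 / 2 * k) := by
  have hr0 : 0 < r := by linarith
  have ht : 0 ≤ (1 - (r ^ 2)⁻¹) / 2 := by
    have : (r ^ 2)⁻¹ ≤ 1 := inv_le_one_of_one_le₀ (by nlinarith)
    linarith
  refine (measure_ge_le_exp_mul_mgf _ ht (integrable_exp_sum_sq_gaussPi k hr0)).trans ?_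
  rw [mgf_sum_sq_gaussPi k hr0]
  exact exp_mul_pow_le k hr0

/-- Lower tail of a chi-square variable with `k` degrees of freedom. -/
lemma gaussPi_lower_tail (k : ℕ) {r : ℝ} (hr0 : 0 < r) (hr : r ≤ 1) :
    (gaussPi k).real {z | ∑ i, z i ^ 2 ≤ r ^ 2 * k} ≤ exp (-(r - 1) ^ 2 / 2 * k) := by
  have ht : (1 - (r ^ 2)⁻¹) / 2 ≤ 0 := by
    have : 1 ≤ (r ^ 2)⁻¹ := (one_le_inv₀ (by positivity)).2 (by nlinarith)
    linarith
  refine (measure_le_le_exp_mul_mgf _ ht (integrable_exp_sum_sq_gaussPi k hr0)).trans ?_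
  rw [mgf_sum_sq_gaussPi k hr0]
  exact exp_mul_pow_le k hr0

/-- The inner product of a standard Gaussian vector with a unit vector is standard Gaussian. -/
lemma map_sum_mul_gaussPi {d : ℕ} {v : Fin d → ℝ} (hv : ∑ j, v j ^ 2 = 1) :
    (gaussPi d).map (fun a ↦ ∑ j, a j * v j) = gaussianReal 0 1 := by
  have hm : Measurable fun a : Fin d → ℝ ↦ ∑ j, a j * v j := by fun_prop
  have : IsProbabilityMeasure ((gaussPi d).map fun a ↦ ∑ j, a j * v j) :=
    Measure.isProbabilityMeasure_map hm.aemeasurable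
  refine Measure.ext_of_charFun (funext fun t ↦ ?_)
  rw [charFun_apply_real, integral_map hm.aemeasurable (by fun_prop), charFun_gaussianReal]
  have h (a : Fin d → ℝ) : Complex.exp (t * (∑ j, a j * v j : ℝ) * Complex.I) =
      ∏ j, Complex.exp ((t * v j : ℝ) * a j * Complex.I) := by
    rw [← Complex.exp_sum]
    push_cast
    rw [Finset.mul_sum, Finset.sum_mul]
    congr! 2
    ring
  simp_rw [h, gaussPi]
  rw [integral_fintype_prod_eq_prod
    fun (j : Fin d) (x : ℝ) ↦ Complex.exp ((t * v j : ℝ) * x * Complex.I)]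
  simp_rw [← charFun_apply_real, charFun_gaussianReal]
  rw [← Complex.exp_sum]
  congr 1
  have hv' : ∑ j, (v j : ℂ) ^ 2 = 1 := by exact_mod_cast hv
  push_cast
  simp only [mul_zero, zero_mul, zero_sub, one_mul, mul_pow]
  rw [Finset.sum_neg_distrib, ← Finset.sum_div, ← Finset.mul_sum, hv', mul_one]

/-- A matrix with standard Gaussian entries maps a unit vector to a standard Gaussian vector. -/
lemma measurePreserving_mulVec_gaussPi {d : ℕ} (k : ℕ) {v : Fin d → ℝ}
    (hv : ∑ j, v j ^ 2 = 1) :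
    MeasurePreserving (fun (A : Fin k → Fin d → ℝ) i ↦ ∑ j, A i j * v j)
      (Measure.pi fun _ ↦ gaussPi d) (gaussPi k) :=
  measurePreserving_pi _ _ fun _ ↦ ⟨by fun_prop, map_sum_mul_gaussPi hv⟩

lemma l2norm_const_mul {ι : Type*} [Fintype ι] (c : ℝ) (x : ι → ℝ) :
    l2norm (fun i ↦ c * x i) = |c| * l2norm x := by
  simp only [l2norm, mul_pow]
  rw [← Finset.mul_sum, sqrt_mul (sq_nonneg c), sqrt_sq_eq_abs]

/-- The relative distortion of the norm of a unit vector exceeds `ε` with small probability. -/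
lemma measureReal_distortion_unit_le {d k : ℕ} (hk : k ≠ 0) {ε : ℝ} (hε0 : 0 < ε) (hε1 : ε < 1)
    {v : Fin d → ℝ} (hv : ∑ j, v j ^ 2 = 1) :
    (Measure.pi fun _ : Fin k ↦ gaussPi d).real
      {A | ¬ (1 - ε ≤ 1 / √k * l2norm (fun i ↦ ∑ j, A i j * v j) ∧
        1 / √k * l2norm (fun i ↦ ∑ j, A i j * v j) ≤ 1 + ε)} ≤
      2 * exp (-ε ^ 2 / 2 * k) := by
  have hm := measurePreserving_mulVec_gaussPi k hv
  have hk' : 0 < √(k : ℝ) := sqrt_pos.2 (by positivity)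
  set U : Set (Fin k → ℝ) := {z | (1 + ε) ^ 2 * k ≤ ∑ i, z i ^ 2}
  set L : Set (Fin k → ℝ) := {z | ∑ i, z i ^ 2 ≤ (1 - ε) ^ 2 * k}
  have hU : MeasurableSet U := measurableSet_le (by fun_prop) (by fun_prop)
  have hL : MeasurableSet L := measurableSet_le (by fun_prop) (by fun_prop)
  have hsub : {A : Fin k → Fin d → ℝ | ¬ (1 - ε ≤ 1 / √k * l2norm (fun i ↦ ∑ j, A i j * v j) ∧
        1 / √k * l2norm (fun i ↦ ∑ j, A i j * v j) ≤ 1 + ε)} ⊆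
      (fun A i ↦ ∑ j, A i j * v j) ⁻¹' U ∪ (fun A i ↦ ∑ j, A i j * v j) ⁻¹' L := by
    intro A hA
    by_contra hA'
    refine hA ?_
    simp only [Set.mem_union, Set.mem_preimage, U, L, Set.mem_ofPred_eq, not_or, not_le] at hA'
    simp only [one_div, inv_mul_eq_div, le_div_iff₀ hk',
      div_le_iff₀ hk', l2norm]
    constructor
    · refine le_sqrt_of_sq_le ?_
      rw [mul_pow, sq_sqrt (by positivity)]
      exact hA'.2.le
    · refine sqrt_le_iff.2 ⟨by positivity, ?_⟩
      rw [mul_pow, sq_sqrt (by positivity)]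
      exact hA'.1.le
  refine (measureReal_mono hsub).trans ((measureReal_union_le _ _).trans ?_)
  rw [hm.measureReal_preimage hU.nullMeasurableSet, hm.measureReal_preimage hL.nullMeasurableSet,
    two_mul]
  have h₁ := gaussPi_upper_tail k (r := 1 + ε) (by linarith)
  have h₂ := gaussPi_lower_tail k (r := 1 - ε) (by linarith) (by linarith)
  rw [show 1 + ε - 1 = ε by ring] at h₁
  rw [show 1 - ε - 1 = -ε by ring, neg_sq] at h₂
  exact add_le_add h₁ h₂

lemma measureReal_distortion_le {d k : ℕ} {ε : ℝ} (hε0 : 0 < ε) (hε1 : ε < 1)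
    (u : Fin d → ℝ) :
    (Measure.pi fun _ : Fin k ↦ gaussPi d).real
      {A | ¬ ((1 - ε) * l2norm u ≤ 1 / √k * l2norm (fun i ↦ ∑ j, A i j * u j) ∧
        1 / √k * l2norm (fun i ↦ ∑ j, A i j * u j) ≤ (1 + ε) * l2norm u)} ≤
      2 * exp (-ε ^ 2 / 2 * k) := by
  rcases eq_or_ne k 0 with rfl | hk
  · refine measureReal_le_one.trans ?_
    norm_num
  have hnonneg : 0 ≤ ∑ j, u j ^ 2 := by positivity
  rcases hnonneg.eq_or_lt with h0 | hpos
  · have hu : u = 0 := by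
      ext j
      simpa using (Finset.sum_eq_zero_iff_of_nonneg fun j _ ↦ sq_nonneg (u j)).1 h0.symm j
    simp only [hu, l2norm, Pi.zero_apply, mul_zero, Finset.sum_const_zero, ne_eq,
      OfNat.ofNat_ne_zero, not_false_eq_true, zero_pow, sqrt_zero, le_refl, and_self, not_true,
      Set.ofPred_false, measureReal_empty]
    positivity
  have hl : 0 < l2norm u := sqrt_pos.2 hpos
  have hv : ∑ j, ((l2norm u)⁻¹ * u j) ^ 2 = 1 := by
    simp_rw [mul_pow]
    rw [← Finset.mul_sum, inv_pow, l2norm, sq_sqrt hnonneg, inv_mul_cancel₀ hpos.ne']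
  convert measureReal_distortion_unit_le hk hε0 hε1 hv using 5 with A
  have hA : l2norm (fun i ↦ ∑ j, A i j * ((l2norm u)⁻¹ * u j)) =
      (l2norm u)⁻¹ * l2norm (fun i ↦ ∑ j, A i j * u j) := by
    rw [← abs_of_pos (inv_pos.2 hl), ← l2norm_const_mul, abs_of_pos (inv_pos.2 hl)]
    congr! 2 with i
    rw [Finset.mul_sum]
    congr! 1
    ring
  rw [hA, mul_left_comm, inv_mul_eq_div, le_div_iff₀ hl, div_le_iff₀ hl]

/-- **Johnson–Lindenstrauss lemma.** For a set `S` of `N` points in `ℝ^d`, `0 < ε < 1`, and a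
random `k × d` matrix `A` with i.i.d. standard Gaussian entries, with probability at least
`1 - 2 N² exp(-(ε² - ε³) k / 4)` every pair `x, y ∈ S` satisfies
`(1-ε)‖x-y‖₂ ≤ (1/√k)‖A(x-y)‖₂ ≤ (1+ε)‖x-y‖₂`. -/
theorem stmt0 {d k N : ℕ} (S : Finset (Fin d → ℝ)) (hS : S.card = N)
    (ε : ℝ) (hε0 : 0 < ε) (hε1 : ε < 1) :
    1 - 2 * (N : ℝ) ^ 2 * Real.exp (-(ε ^ 2 - ε ^ 3) * k / 4) ≤
      ((Measure.pi fun _ : Fin k => gaussPi d)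
        {A : Fin k → Fin d → ℝ | ∀ x ∈ S, ∀ y ∈ S,
          (1 - ε) * l2norm (x - y) ≤ (1 / Real.sqrt k) * l2norm (fun i => ∑ j, A i j * (x - y) j)
          ∧ (1 / Real.sqrt k) * l2norm (fun i => ∑ j, A i j * (x - y) j)
              ≤ (1 + ε) * l2norm (x - y)}).toReal := by
  set μ := Measure.pi fun _ : Fin k => gaussPi d
  set G : (Fin d → ℝ) → Set (Fin k → Fin d → ℝ) := fun u ↦ {A |
    (1 - ε) * l2norm u ≤ 1 / √k * l2norm (fun i ↦ ∑ j, A i j * u j) ∧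
      1 / √k * l2norm (fun i ↦ ∑ j, A i j * u j) ≤ (1 + ε) * l2norm u}
  set E : Set (Fin k → Fin d → ℝ) := {A | ∀ x ∈ S, ∀ y ∈ S, A ∈ G (x - y)}
  change _ ≤ μ.real E
  have hbad : μ.real (⋃ p ∈ S ×ˢ S, (G (p.1 - p.2))ᶜ) ≤
      2 * (N : ℝ) ^ 2 * exp (-(ε ^ 2 - ε ^ 3) * k / 4) := by
    refine (measureReal_biUnion_finset_le _ _).trans ?_
    refine (Finset.sum_le_card_nsmul _ _ (2 * exp (-(ε ^ 2 - ε ^ 3) * k / 4))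
      fun p _ ↦ (measureReal_distortion_le hε0 hε1 (p.1 - p.2)).trans ?_).trans_eq ?_
    · have : (0 : ℝ) ≤ (ε ^ 2 + ε ^ 3) * k := by positivity
      gcongr
      linarith
    · rw [Finset.card_product, hS, nsmul_eq_mul]
      push_cast
      ring
  have hcover : Set.univ ⊆ E ∪ ⋃ p ∈ S ×ˢ S, (G (p.1 - p.2))ᶜ := by
    intro A _
    by_cases hA : A ∈ E
    · exact .inl hA
    · simp only [E, Set.mem_ofPred_eq, not_forall] at hA
      obtain ⟨x, hx, y, hy, h⟩ := hA
      exact .inr (Set.mem_biUnion (x := (x, y)) (by simp [hx, hy]) h)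
  have hone : 1 ≤ μ.real E + μ.real (⋃ p ∈ S ×ˢ S, (G (p.1 - p.2))ᶜ) := by
    rw [← probReal_univ (μ := μ)]
    exact (measureReal_mono hcover).trans (measureReal_union_le _ _)
  linarith

end
end

section
/- Let x, y be nonzero vectors in ℝ^d and let r be a random vector drawn from N(0, I_d) (i.i.d. standard Gaussian entries). Then Pr[ sign(⟨x, r⟩) ≠ sign(⟨y, r⟩) ] = ∠(x,y)/π, where ∠(x,y) is the angle between x and y. -/
open MeasureTheory ProbabilityTheory Real
open scoped ENNReal

noncomputable section

lemma charFunDual_map_dotp_prod {d : ℕ} (x y : Fin d → ℝ) (L : StrongDual ℝ (ℝ × ℝ)) :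
    charFunDual ((gaussPi d).map fun r => (dotp x r, dotp y r)) L =
      Complex.exp (-((L (1, 0) ^ 2 * dotp x x + 2 * L (1, 0) * L (0, 1) * dotp x y +
        L (0, 1) ^ 2 * dotp y y : ℝ) : ℂ) / 2) := by
  have hL (a b : ℝ) : L (a, b) = a * L (1, 0) + b * L (0, 1) := by
    have : ((a, b) : ℝ × ℝ) = a • (1, 0) + b • (0, 1) := by simp
    rw [this, map_add, map_smul, map_smul, smul_eq_mul, smul_eq_mul]
  set p := L (1, 0)
  set q := L (0, 1)
  have h := charFun_stdGaussian (E := EuclideanSpace ℝ (Fin d)) (WithLp.toLp 2 (p • x + q • y))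
  rw [← map_pi_eq_stdGaussian, charFun_apply, integral_map (by fun_prop) (by fun_prop)] at h
  rw [charFunDual_apply, integral_map (by unfold dotp; fun_prop) (by fun_prop)]
  convert h using 1
  · refine integral_congr_ae (ae_of_all _ fun r => ?_)
    simp only [hL]
    congr 3
    simp only [dotp, PiLp.inner_apply, Finset.sum_mul, ← Finset.sum_add_distrib]
    refine Finset.sum_congr rfl fun i _ => ?_
    simp
    ring
  · rw [← Complex.ofReal_pow, EuclideanSpace.real_norm_sq_eq]
    congr 4
    simp only [dotp, Finset.mul_sum, ← Finset.sum_add_distrib]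
    refine Finset.sum_congr rfl fun i _ => ?_
    simp
    ring

lemma map_dotp_prod_eq {d e : ℕ} {x y : Fin d → ℝ} {u v : Fin e → ℝ}
    (hxx : dotp x x = dotp u u) (hxy : dotp x y = dotp u v) (hyy : dotp y y = dotp v v) :
    (gaussPi d).map (fun r => (dotp x r, dotp y r)) =
      (gaussPi e).map fun r => (dotp u r, dotp v r) := by
  refine Measure.ext_of_charFunDual (funext fun L => ?_)
  rw [charFunDual_map_dotp_prod, charFunDual_map_dotp_prod, hxx, hxy, hyy]

lemma gaussianPDFReal_polar (s φ : ℝ) :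
    gaussianPDFReal 0 1 (s * cos φ) * gaussianPDFReal 0 1 (s * sin φ) =
      (√(2 * π))⁻¹ ^ 2 * exp (-s ^ 2 / 2) := by
  have h : -s ^ 2 / 2 = -(s * cos φ) ^ 2 / 2 + -(s * sin φ) ^ 2 / 2 := by
    linear_combination (s ^ 2 / 2) * sin_sq_add_cos_sq φ
  rw [h, exp_add]
  simp only [gaussianPDFReal, sub_zero, NNReal.coe_one, mul_one]
  ring

lemma gaussian_prod_apply_of_polar {S : Set (ℝ × ℝ)} {T : Set ℝ} (hS : MeasurableSet S)
    (hT : MeasurableSet T)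
    (h : ∀ s > 0, ∀ φ ∈ Set.Ioo (-π) π, (s * cos φ, s * sin φ) ∈ S ↔ φ ∈ T) :
    (gaussianReal 0 1).prod (gaussianReal 0 1) S =
      (∫⁻ s in Set.Ioi (0 : ℝ), ENNReal.ofReal (s * ((√(2 * π))⁻¹ ^ 2 * exp (-s ^ 2 / 2)))) *
        volume (T ∩ Set.Ioo (-π) π) := by
  rw [gaussianReal_of_var_ne_zero 0 one_ne_zero,
    prod_withDensity (measurable_gaussianPDF 0 1) (measurable_gaussianPDF 0 1),
    withDensity_apply _ hS, ← lintegral_indicator hS, ← Measure.volume_eq_prod,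
    ← lintegral_comp_polarCoord_symm, ← Measure.restrict_apply hT, ← lintegral_indicator_one hT,
    ← lintegral_prod_mul (by fun_prop) ((measurable_one.indicator hT).aemeasurable),
    Measure.prod_restrict, ← Measure.volume_eq_prod, polarCoord_target]
  refine setLIntegral_congr_fun (measurableSet_Ioi.prod measurableSet_Ioo) ?_
  rintro ⟨s, φ⟩ ⟨hs, hφ⟩
  have hs' : 0 < s := hs
  have key := h s hs φ hφ
  simp only [polarCoord_symm_apply]
  by_cases hm : φ ∈ T
  · rw [Set.indicator_of_mem (key.2 hm), Set.indicator_of_mem hm]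
    simp only [gaussianPDF, smul_eq_mul, Pi.one_apply, mul_one]
    rw [← ENNReal.ofReal_mul (gaussianPDFReal_nonneg _ _ _), gaussianPDFReal_polar,
      ENNReal.ofReal_mul hs'.le]
  · rw [Set.indicator_of_notMem (mt key.1 hm), Set.indicator_of_notMem hm, smul_zero, mul_zero]

lemma gaussian_prod_toReal_of_polar {S : Set (ℝ × ℝ)} {T : Set ℝ} (hS : MeasurableSet S)
    (hT : MeasurableSet T)
    (h : ∀ s > 0, ∀ φ ∈ Set.Ioo (-π) π, (s * cos φ, s * sin φ) ∈ S ↔ φ ∈ T) :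
    ((gaussianReal 0 1).prod (gaussianReal 0 1) S).toReal =
      (volume (T ∩ Set.Ioo (-π) π)).toReal / (2 * π) := by
  have h1 := gaussian_prod_apply_of_polar MeasurableSet.univ MeasurableSet.univ (by simp)
  rw [measure_univ, Set.univ_inter, Real.volume_Ioo] at h1
  rw [gaussian_prod_apply_of_polar hS hT h, ENNReal.toReal_mul]
  have h2 := congrArg ENNReal.toReal h1
  rw [ENNReal.toReal_mul, ENNReal.toReal_one, ENNReal.toReal_ofReal (by linarith [pi_pos])] at h2
  rw [eq_div_iff (by positivity)]
  linear_combination -(volume (T ∩ Set.Ioo (-π) π)).toReal * h2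

lemma measurable_sgn : Measurable sgn :=
  Measurable.ite measurableSet_Ici measurable_const measurable_const

lemma sgn_mul_of_pos {a : ℝ} (ha : 0 < a) (t : ℝ) : sgn (a * t) = sgn t := by
  simp [sgn, mul_nonneg_iff_of_pos_left ha]

lemma sgn_ne_of_mul_neg {a b : ℝ} (h : a * b < 0) : sgn a ≠ sgn b := by
  rcases mul_neg_iff.1 h with ⟨ha, hb⟩ | ⟨ha, hb⟩ <;>
    norm_num [sgn, ha.le, hb.le, ha.not_ge, hb.not_ge]

lemma mul_nonpos_of_sgn_ne {a b : ℝ} (h : sgn a ≠ sgn b) : a * b ≤ 0 := by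
  contrapose! h
  rcases mul_pos_iff.1 h with ⟨ha, hb⟩ | ⟨ha, hb⟩ <;>
    simp [sgn, ha.le, hb.le, ha.not_ge, hb.not_ge]

lemma cos_sub_mul_cos_add (φ h : ℝ) :
    cos (φ - h) * cos (φ + h) = cos φ ^ 2 - cos (π / 2 - h) ^ 2 := by
  rw [cos_sub, cos_add, cos_pi_div_two_sub]
  linear_combination cos φ ^ 2 * sin_sq_add_cos_sq h - sin h ^ 2 * sin_sq_add_cos_sq φ

lemma cos_sub_mul_cos_add_neg {φ h : ℝ} (h1 : h ≤ π / 2) (hl : π / 2 - h < |φ|)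
    (hr : |φ| < π / 2 + h) : cos (φ - h) * cos (φ + h) < 0 := by
  have hlt : cos |φ| < cos (π / 2 - h) :=
    cos_lt_cos_of_nonneg_of_le_pi (by linarith) (by linarith) hl
  have hgt : cos (π - (π / 2 - h)) < cos |φ| :=
    cos_lt_cos_of_nonneg_of_le_pi (abs_nonneg _) (by linarith) (by linarith)
  rw [cos_pi_sub] at hgt
  rw [cos_abs] at hlt hgt
  rw [cos_sub_mul_cos_add, sub_neg]
  exact sq_lt_sq' hgt hlt

lemma abs_mem_Icc_of_cos_sub_mul_cos_add_nonpos {φ h : ℝ} (h0 : 0 ≤ h) (h1 : h ≤ π / 2)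
    (hφ : |φ| ≤ π) (hneg : cos (φ - h) * cos (φ + h) ≤ 0) :
    π / 2 - h ≤ |φ| ∧ |φ| ≤ π / 2 + h := by
  rw [cos_sub_mul_cos_add, sub_nonpos] at hneg
  have hc : 0 ≤ cos (π / 2 - h) := cos_nonneg_of_mem_Icc ⟨by linarith, by linarith⟩
  obtain ⟨hl, hr⟩ := abs_le_of_sq_le_sq' hneg hc
  rw [← cos_abs φ] at hl hr
  rw [← cos_pi_sub] at hl
  constructor
  · by_contra! hcon
    exact hr.not_gt (cos_lt_cos_of_nonneg_of_le_pi (abs_nonneg _) (by linarith) hcon)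
  · by_contra! hcon
    exact hl.not_gt (cos_lt_cos_of_nonneg_of_le_pi (by linarith) hφ (by linarith))

lemma volume_sgn_cos_ne {h : ℝ} (h0 : 0 ≤ h) (h1 : h ≤ π / 2) :
    (volume ({φ | sgn (cos (φ - h)) ≠ sgn (cos (φ + h))} ∩ Set.Ioo (-π) π)).toReal = 4 * h := by
  have hvol : volume ({φ | sgn (cos (φ - h)) ≠ sgn (cos (φ + h))} ∩ Set.Ioo (-π) π) =
      ENNReal.ofReal (2 * h) + ENNReal.ofReal (2 * h) := by
    apply le_antisymm
    · calc
        _ ≤ volume (Set.Icc (π / 2 - h) (π / 2 + h) ∪ Set.Icc (-(π / 2 + h)) (-(π / 2 - h))) := by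
          refine measure_mono ?_
          rintro φ ⟨hne, hφ⟩
          obtain ⟨hl, hr⟩ := abs_mem_Icc_of_cos_sub_mul_cos_add_nonpos h0 h1
            (abs_lt.2 hφ).le (mul_nonpos_of_sgn_ne hne)
          obtain ⟨hr1, hr2⟩ := abs_le.1 hr
          rcases le_abs.1 hl with hl | hl
          · exact Or.inl ⟨hl, hr2⟩
          · exact Or.inr ⟨hr1, by linarith⟩
        _ ≤ _ := measure_union_le _ _
        _ = _ := by
          rw [Real.volume_Icc, Real.volume_Icc]
          ring_nf
    · calc
        _ = volume (Set.Ioo (π / 2 - h) (π / 2 + h) ∪ Set.Ioo (-(π / 2 + h)) (-(π / 2 - h))) := by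
          rw [measure_union _ measurableSet_Ioo, Real.volume_Ioo, Real.volume_Ioo]
          · ring_nf
          · refine Set.disjoint_left.2 ?_
            rintro φ ⟨ha, -⟩ ⟨-, hb⟩
            linarith
        _ ≤ _ := by
          refine measure_mono fun φ hφ => ?_
          have habs : π / 2 - h < |φ| ∧ |φ| < π / 2 + h := by
            rcases hφ with ⟨ha, hb⟩ | ⟨ha, hb⟩
            · exact ⟨lt_abs.2 (Or.inl ha), abs_lt.2 ⟨by linarith, hb⟩⟩
            · exact ⟨lt_abs.2 (Or.inr (by linarith)), abs_lt.2 ⟨ha, by linarith⟩⟩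
          exact ⟨sgn_ne_of_mul_neg (cos_sub_mul_cos_add_neg h1 habs.1 habs.2),
            abs_lt.1 (by linarith [habs.2])⟩
  rw [hvol, ← ENNReal.ofReal_add (by linarith) (by linarith), ENNReal.toReal_ofReal (by linarith)]
  ring

lemma gaussPi_two_sgn_ne {a b h : ℝ} (ha : 0 < a) (hb : 0 < b) (h0 : 0 ≤ h) (h1 : h ≤ π / 2) :
    ((gaussPi 2) {r | sgn (dotp ![a * cos h, a * sin h] r) ≠
      sgn (dotp ![b * cos h, -(b * sin h)] r)}).toReal = 2 * h / π := by
  set S : Set (ℝ × ℝ) := {p | sgn (a * cos h * p.1 + a * sin h * p.2) ≠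
    sgn (b * cos h * p.1 + -(b * sin h) * p.2)}
  have hS : MeasurableSet S :=
    (measurableSet_eq_fun (measurable_sgn.comp (by fun_prop))
      (measurable_sgn.comp (by fun_prop))).compl
  have hT : MeasurableSet {φ | sgn (cos (φ - h)) ≠ sgn (cos (φ + h))} :=
    (measurableSet_eq_fun (measurable_sgn.comp (by fun_prop))
      (measurable_sgn.comp (by fun_prop))).compl
  have hpre : {r | sgn (dotp ![a * cos h, a * sin h] r) ≠
      sgn (dotp ![b * cos h, -(b * sin h)] r)} = MeasurableEquiv.finTwoArrow ⁻¹' S := by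
    ext r
    simp [S, dotp, Fin.sum_univ_two]
  rw [hpre, gaussPi, (measurePreserving_finTwoArrow (gaussianReal 0 1)).measure_preimage
    hS.nullMeasurableSet, gaussian_prod_toReal_of_polar hS hT, volume_sgn_cos_ne h0 h1]
  · field_simp
    ring
  · intro s hs φ _
    have e1 : a * cos h * (s * cos φ) + a * sin h * (s * sin φ) = a * (s * cos (φ - h)) := by
      rw [cos_sub]; ring
    have e2 : b * cos h * (s * cos φ) + -(b * sin h) * (s * sin φ) = b * (s * cos (φ + h)) := by
      rw [cos_add]; ring
    simp only [S, Set.mem_ofPred_eq, e1, e2, sgn_mul_of_pos ha, sgn_mul_of_pos hb,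
      sgn_mul_of_pos hs]

lemma l2norm_pos {ι : Type*} [Fintype ι] {x : ι → ℝ} (hx : x ≠ 0) : 0 < l2norm x := by
  obtain ⟨i, hi⟩ := Function.ne_iff.1 hx
  exact Real.sqrt_pos.2 (Finset.sum_pos' (fun j _ => sq_nonneg _)
    ⟨i, Finset.mem_univ i, sq_pos_of_ne_zero hi⟩)

lemma dotp_self {ι : Type*} [Fintype ι] (x : ι → ℝ) : dotp x x = l2norm x ^ 2 := by
  rw [l2norm, Real.sq_sqrt (Finset.sum_nonneg fun i _ => sq_nonneg _)]
  simp [dotp, sq]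

lemma abs_dotp_le {ι : Type*} [Fintype ι] (x y : ι → ℝ) :
    |dotp x y| ≤ l2norm x * l2norm y := by
  rw [l2norm, l2norm, ← Real.sqrt_mul (Finset.sum_nonneg fun i _ => sq_nonneg _)]
  exact Real.abs_le_sqrt (Finset.sum_mul_sq_le_sq_mul_sq _ _ _)

lemma l2norm_mul_cos_angle' {ι : Type*} [Fintype ι] {x y : ι → ℝ} (hx : x ≠ 0) (hy : y ≠ 0) :
    l2norm x * l2norm y * cos (angle' x y) = dotp x y := by
  have hpos := mul_pos (l2norm_pos hx) (l2norm_pos hy)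
  obtain ⟨hl, hr⟩ := abs_le.1 (abs_dotp_le x y)
  rw [angle', cos_arccos, mul_div_cancel₀ _ hpos.ne']
  · rw [le_div_iff₀ hpos]
    linarith
  · rw [div_le_one hpos]
    exact hr

/-- For nonzero `x, y ∈ ℝ^d` and a standard Gaussian vector `r`,
`Pr[sign⟨x,r⟩ ≠ sign⟨y,r⟩] = ∠(x,y)/π`. -/
theorem stmt1 {d : ℕ} (x y : Fin d → ℝ) (hx : x ≠ 0) (hy : y ≠ 0) :
    ((gaussPi d) {r | sgn (dotp x r) ≠ sgn (dotp y r)}).toReal = angle' x y / π := by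
  have hcos := l2norm_mul_cos_angle' hx hy
  have h0 : 0 ≤ angle' x y := arccos_nonneg _
  have h1 : angle' x y ≤ π := arccos_le_pi _
  set θ := angle' x y
  have hsq := sin_sq_add_cos_sq (θ / 2)
  have hdouble : cos θ = cos (θ / 2) ^ 2 - sin (θ / 2) ^ 2 := by
    rw [← cos_two_mul', mul_div_cancel₀ θ two_ne_zero]
  have hmap := map_dotp_prod_eq (x := x) (y := y)
    (u := ![l2norm x * cos (θ / 2), l2norm x * sin (θ / 2)])
    (v := ![l2norm y * cos (θ / 2), -(l2norm y * sin (θ / 2))])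
    (by rw [dotp_self]; simp [dotp]; linear_combination -l2norm x ^ 2 * hsq)
    (by rw [← hcos]; simp [dotp]; linear_combination l2norm x * l2norm y * hdouble)
    (by rw [dotp_self]; simp [dotp]; linear_combination -l2norm y ^ 2 * hsq)
  have hS : MeasurableSet {p : ℝ × ℝ | sgn p.1 ≠ sgn p.2} :=
    (measurableSet_eq_fun (measurable_sgn.comp measurable_fst)
      (measurable_sgn.comp measurable_snd)).compl
  have hm := congrArg (fun μ => μ {p : ℝ × ℝ | sgn p.1 ≠ sgn p.2}) hmap
  rw [Measure.map_apply (by unfold dotp; fun_prop) hS,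
    Measure.map_apply (by unfold dotp; fun_prop) hS] at hm
  have h2 := gaussPi_two_sgn_ne (l2norm_pos hx) (l2norm_pos hy)
    (h := θ / 2) (by linarith) (by linarith)
  rw [mul_div_cancel₀ θ two_ne_zero] at h2
  rw [← h2]
  exact congrArg ENNReal.toReal hm

end
end
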